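/- There exists a universal constant C > 0 such that for every r > 0 and every continuously differentiable function ψ : ℝ³ → ℝ, the average over the sphere ∂B_r(0) of the deviation of ψ from its ball average satisfies (1/σ_r(∂B_r(0))) ∫_{∂B_r(0)} | ψ(x) − (1/|B_r(0)|) ∫_{B_r(0)} ψ(y) dy | dσ_r(x) ≤ C r^{−1/2} ‖∇ψ‖_{L²(B_r(0))}. -/

import Mathlib

open MeasureTheory Real

open Set Metric in
theorem lintegral_eq_lintegral_toSphere {E : Type*} [NormedAddCommGroup E] [NormedSpace ℝ E]
    [FiniteDimensional ℝ E] [Nontrivial E] [MeasurableSpace E] [BorelSpace E] (μ : Measure E)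
    [μ.IsAddHaarMeasure] {f : E → ENNReal} (hf : Measurable f) :
    ∫⁻ x, f x ∂μ = ∫⁻ n : sphere (0 : E) 1, ∫⁻ s in Ioi (0 : ℝ),
      ENNReal.ofReal (s ^ (Module.finrank ℝ E - 1)) * f (s • (n : E)) ∂volume ∂μ.toSphere := by
  have hg : Measurable fun p : sphere (0 : E) 1 × Ioi (0 : ℝ) ↦ f ((p.2 : ℝ) • (p.1 : E)) :=
    hf.comp (by fun_prop)
  calc
    ∫⁻ x, f x ∂μ = ∫⁻ x : ({(0)}ᶜ : Set E), f x ∂(μ.comap (↑)) := by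
      rw [lintegral_subtype_comap (measurableSet_singleton _).compl f, restrict_compl_singleton]
    _ = ∫⁻ p : sphere (0 : E) 1 × Ioi (0 : ℝ), f ((p.2 : ℝ) • (p.1 : E))
          ∂μ.toSphere.prod (.volumeIoiPow (Module.finrank ℝ E - 1)) := by
      rw [← μ.measurePreserving_homeomorphUnitSphereProd.lintegral_comp hg]
      refine lintegral_congr fun x ↦ ?_
      have hx : ‖(x : E)‖ ≠ 0 := norm_ne_zero_iff.2 x.2
      simp [smul_smul, hx]
    _ = _ := by
      rw [lintegral_prod _ hg.aemeasurable]
      refine lintegral_congr fun n ↦ ?_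
      rw [Measure.volumeIoiPow, lintegral_withDensity_eq_lintegral_mul _ (by fun_prop)
        (g := fun y : Ioi (0 : ℝ) ↦ f ((y : ℝ) • (n : E)))
        (hg.comp (measurable_prodMk_left (x := n)))]
      exact lintegral_subtype_comap measurableSet_Ioi fun s : ℝ ↦
        ENNReal.ofReal (s ^ (Module.finrank ℝ E - 1)) * f (s • (n : E))

open Set Metric in
theorem lintegral_toSphere_enorm_le {E : Type*} [NormedAddCommGroup E] [NormedSpace ℝ E]
    [FiniteDimensional ℝ E] [Nontrivial E] [MeasurableSpace E] [BorelSpace E] (μ : Measure E)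
    [μ.IsAddHaarMeasure] {h : E → ℝ} (hh : ContDiff ℝ 1 h) :
    ∫⁻ n : sphere (0 : E) 1, ‖h n‖ₑ ∂μ.toSphere ≤
      Module.finrank ℝ E * ∫⁻ x in ball (0 : E) 1, ‖h x‖ₑ ∂μ +
        ∫⁻ x in ball (0 : E) 1, ‖fderiv ℝ h x‖ₑ ∂μ := by
  have hh' : Continuous (fderiv ℝ h) := hh.continuous_fderiv one_ne_zero
  obtain ⟨k, hk⟩ : ∃ k, Module.finrank ℝ E = k + 1 :=
    Nat.exists_eq_succ_of_ne_zero Module.finrank_pos.ne'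
  set F : E → ENNReal := fun x ↦ Module.finrank ℝ E * ‖h x‖ₑ + ‖fderiv ℝ h x‖ₑ with hF
  have hhm : Measurable fun x ↦ ‖h x‖ₑ := hh.continuous.enorm.measurable
  have hFm : Measurable F := by
    have := hh'.enorm.measurable
    fun_prop
  have hn (n : sphere (0 : E) 1) : ‖h n‖ₑ ≤ ∫⁻ s in Ioi (0 : ℝ),
      ENNReal.ofReal (s ^ k) * (ball (0 : E) 1).indicator F (s • (n : E)) := by
    have hd (s : ℝ) : HasDerivAt (fun s : ℝ ↦ s ^ (k + 1) * h (s • (n : E)))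
        ((k + 1 : ℕ) * s ^ k * h (s • (n : E)) + s ^ (k + 1) * fderiv ℝ h (s • (n : E)) n) s := by
      have h1 : HasDerivAt (fun s : ℝ ↦ s • (n : E)) ((1 : ℝ) • (n : E)) s :=
        (hasDerivAt_id s).smul_const _
      have h2 := ((hh.differentiable one_ne_zero) (s • (n : E))).hasFDerivAt.comp_hasDerivAt s h1
      have h3 := (hasDerivAt_pow (k + 1) s).mul h2
      simpa using! h3
    have hc : ContDiffOn ℝ 1 (fun s : ℝ ↦ s ^ (k + 1) * h (s • (n : E))) (Icc 0 1) :=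
      ContDiff.contDiffOn (by fun_prop)
    have h0 := enorm_sub_le_lintegral_deriv_of_contDiffOn_Icc hc zero_le_one
    simp only [one_pow, one_smul, one_mul, ne_eq, Nat.add_eq_zero_iff, one_ne_zero, and_false,
      not_false_eq_true, zero_pow, zero_mul, sub_zero] at h0
    refine h0.trans ?_
    rw [← restrict_Ioo_eq_restrict_Icc]
    refine (setLIntegral_mono' measurableSet_Ioo fun s hs ↦ ?_).trans
      (lintegral_mono_set Ioo_subset_Ioi_self)
    have hb : s • (n : E) ∈ ball (0 : E) 1 := by
      simp [norm_smul, abs_of_pos hs.1, hs.2]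
    have hs0 : 0 ≤ s ^ k := pow_nonneg hs.1.le k
    rw [(hd s).deriv, indicator_of_mem hb]
    simp only [hF]
    rw [← ofReal_norm, ← ofReal_norm, ← ofReal_norm, hk, ← ENNReal.ofReal_natCast, ← ENNReal.ofReal_mul (by positivity),
      ← ENNReal.ofReal_add (by positivity) (by positivity), ← ENNReal.ofReal_mul hs0]
    refine ENNReal.ofReal_le_ofReal ((norm_add_le _ _).trans ?_)
    have h4 : ‖fderiv ℝ h (s • (n : E)) n‖ ≤ ‖fderiv ℝ h (s • (n : E))‖ := by
      simpa using (fderiv ℝ h (s • (n : E))).le_opNorm n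
    rw [norm_mul, norm_mul, norm_mul, norm_natCast, norm_of_nonneg hs0,
      norm_of_nonneg (pow_nonneg hs.1.le _), mul_add]
    have h5 : s ^ (k + 1) ≤ s ^ k := pow_le_pow_of_le_one hs.1.le hs.2.le k.le_succ
    have := mul_le_mul h5 h4 (norm_nonneg _) hs0
    linarith
  calc
    _ ≤ _ := lintegral_mono hn
    _ = ∫⁻ x, (ball (0 : E) 1).indicator F x ∂μ := by
      rw [lintegral_eq_lintegral_toSphere μ (hFm.indicator measurableSet_ball), hk,
        Nat.add_sub_cancel]
    _ = _ := by
      rw [lintegral_indicator measurableSet_ball, hF, lintegral_add_left (by fun_prop),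
        lintegral_const_mul _ hhm]

open Set Metric in
theorem setLIntegral_ball_segment_le {E : Type*} [NormedAddCommGroup E] [NormedSpace ℝ E]
    [FiniteDimensional ℝ E] [MeasurableSpace E] [BorelSpace E] (μ : Measure E)
    [μ.IsAddHaarMeasure] {g : E → ENNReal} (hg : Measurable g) {y : E} (hy : y ∈ ball (0 : E) 1)
    {t : ℝ} (ht : 1 / 2 ≤ t) (ht1 : t ≤ 1) :
    ∫⁻ z in ball (0 : E) 1, g ((1 - t) • y + t • z) ∂μ ≤
      2 ^ Module.finrank ℝ E * ∫⁻ z in ball (0 : E) 1, g z ∂μ := by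
  have ht0 : 0 < t := by linarith
  have hG : Measurable ((ball (0 : E) 1).indicator g) := hg.indicator measurableSet_ball
  calc
    _ ≤ ∫⁻ z, (ball (0 : E) 1).indicator g ((1 - t) • y + t • z) ∂μ := by
      rw [← lintegral_indicator measurableSet_ball]
      refine lintegral_mono fun z ↦ ?_
      by_cases hz : z ∈ ball (0 : E) 1
      · have := convex_ball (0 : E) 1 hy hz (by linarith) ht0.le (sub_add_cancel 1 t)
        simp only [indicator_of_mem hz, indicator_of_mem this, le_refl]
      · simp [indicator_of_notMem hz]
    _ = ∫⁻ w, (ball (0 : E) 1).indicator g ((1 - t) • y + w) ∂(μ.map (t • ·)) := by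
      rw [lintegral_map (by fun_prop) (by fun_prop)]
    _ = ENNReal.ofReal |(t ^ Module.finrank ℝ E)⁻¹| * ∫⁻ z in ball (0 : E) 1, g z ∂μ := by
      rw [Measure.map_addHaar_smul μ ht0.ne', lintegral_smul_measure,
        lintegral_add_left_eq_self, lintegral_indicator measurableSet_ball, smul_eq_mul]
    _ ≤ _ := by
      gcongr
      rw [← ENNReal.ofReal_ofNat, ← ENNReal.ofReal_pow (by norm_num)]
      refine ENNReal.ofReal_le_ofReal ?_
      rw [abs_of_pos (by positivity), ← inv_pow]
      gcongr
      rw [inv_le_comm₀ ht0 two_pos]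
      linarith

open Set Metric in
theorem lintegral_lintegral_ball_enorm_sub_le {E : Type*} [NormedAddCommGroup E] [NormedSpace ℝ E]
    [FiniteDimensional ℝ E] [MeasurableSpace E] [BorelSpace E] (μ : Measure E)
    [μ.IsAddHaarMeasure] {ψ : E → ℝ} (hψ : ContDiff ℝ 1 ψ) :
    ∫⁻ y in ball (0 : E) 1, ∫⁻ z in ball (0 : E) 1, ‖ψ y - ψ z‖ₑ ∂μ ∂μ ≤
      2 ^ (Module.finrank ℝ E + 2) * μ (ball (0 : E) 1) *
        ∫⁻ x in ball (0 : E) 1, ‖fderiv ℝ ψ x‖ₑ ∂μ := by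
  set g : E → ENNReal := fun x ↦ ‖fderiv ℝ ψ x‖ₑ with hgdef
  have hg : Measurable g := (hψ.continuous_fderiv one_ne_zero).enorm.measurable
  set I := ∫⁻ x in ball (0 : E) 1, g x ∂μ
  set D := Module.finrank ℝ E
  have hseg {y z : E} (hy : y ∈ ball (0 : E) 1) (hz : z ∈ ball (0 : E) 1) :
      ‖ψ y - ψ z‖ₑ ≤ ∫⁻ t in Icc (0 : ℝ) 1, 2 * g ((1 - t) • y + t • z) := by
    have hc : ContDiff ℝ 1 fun t : ℝ ↦ ψ ((1 - t) • y + t • z) := by fun_prop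
    have h0 := enorm_sub_le_lintegral_deriv_of_contDiffOn_Icc hc.contDiffOn
      (zero_le_one (α := ℝ))
    simp only [sub_self, zero_smul, one_smul, zero_add, sub_zero, add_zero] at h0
    rw [enorm_sub_rev]
    refine h0.trans (lintegral_mono fun t ↦ ?_)
    have h1 : HasDerivAt (fun t : ℝ ↦ (1 - t) • y + t • z) (z - y) t := by
      have := (((hasDerivAt_id t).const_sub 1).smul_const y).add
        ((hasDerivAt_id t).smul_const z)
      simpa [sub_eq_add_neg, add_comm] using! this
    have h2 := ((hψ.differentiable one_ne_zero) _).hasFDerivAt.comp_hasDerivAt t h1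
    rw [show deriv (fun t : ℝ ↦ ψ ((1 - t) • y + t • z)) t = _ from h2.deriv, mul_comm]
    refine (ContinuousLinearMap.le_opENorm _ _).trans ?_
    gcongr
    rw [← ofReal_norm, ← ENNReal.ofReal_ofNat]
    refine ENNReal.ofReal_le_ofReal ((norm_sub_le _ _).trans ?_)
    rw [mem_ball_zero_iff] at hy hz
    linarith
  have hm : Measurable fun p : E × E × ℝ ↦ g ((1 - p.2.2) • p.1 + p.2.2 • p.2.1) :=
    hg.comp (by fun_prop)
  have hbound (t : ℝ) (ht : t ∈ Icc (0 : ℝ) 1) :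
      ∫⁻ y in ball (0 : E) 1, ∫⁻ z in ball (0 : E) 1, g ((1 - t) • y + t • z) ∂μ ∂μ ≤
        2 ^ D * I * μ (ball (0 : E) 1) := by
    rcases le_total (1 / 2) t with h | h
    · refine (setLIntegral_mono' measurableSet_ball fun y hy ↦
        setLIntegral_ball_segment_le μ hg hy h ht.2).trans ?_
      rw [setLIntegral_const]
    · have hmt : Measurable (Function.uncurry fun y z : E ↦ g ((1 - t) • y + t • z)) :=
        hg.comp (by fun_prop)
      rw [lintegral_lintegral_swap hmt.aemeasurable]
      refine (setLIntegral_mono' (g := fun _ ↦ 2 ^ D * I) measurableSet_ball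
        fun z hz ↦ ?_).trans ?_
      · have := setLIntegral_ball_segment_le μ hg hz (t := 1 - t) (by linarith) (by linarith [ht.1])
        simpa [add_comm] using this
      · rw [setLIntegral_const]
  calc
    _ ≤ ∫⁻ y in ball (0 : E) 1, ∫⁻ z in ball (0 : E) 1, ∫⁻ t in Icc (0 : ℝ) 1,
          2 * g ((1 - t) • y + t • z) ∂volume ∂μ ∂μ :=
      setLIntegral_mono' measurableSet_ball fun y hy ↦
        setLIntegral_mono' measurableSet_ball fun z hz ↦ hseg hy hz
    _ = ∫⁻ y in ball (0 : E) 1, ∫⁻ t in Icc (0 : ℝ) 1, ∫⁻ z in ball (0 : E) 1,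
          2 * g ((1 - t) • y + t • z) ∂μ ∂volume ∂μ := by
      refine lintegral_congr fun y ↦ lintegral_lintegral_swap ?_
      exact ((hm.comp (f := fun p : E × ℝ ↦ (y, p)) (by fun_prop)).const_mul 2).aemeasurable
    _ = ∫⁻ t in Icc (0 : ℝ) 1, ∫⁻ y in ball (0 : E) 1, ∫⁻ z in ball (0 : E) 1,
          2 * g ((1 - t) • y + t • z) ∂μ ∂μ ∂volume := by
      refine lintegral_lintegral_swap (Measurable.aemeasurable ?_)
      refine Measurable.lintegral_prod_right' (f := fun q : (E × ℝ) × E ↦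
        2 * g ((1 - q.1.2) • q.1.1 + q.1.2 • q.2)) ?_
      exact (hm.comp (f := fun q : (E × ℝ) × E ↦ (q.1.1, q.2, q.1.2)) (by fun_prop)).const_mul 2
    _ ≤ ∫⁻ t in Icc (0 : ℝ) 1, 4 * (2 ^ D * I * μ (ball (0 : E) 1)) := by
      refine setLIntegral_mono' measurableSet_Icc fun t ht ↦ ?_
      simp_rw [lintegral_const_mul' 2 _ ENNReal.ofNat_ne_top]
      refine (mul_le_mul_right (hbound t ht) 2).trans ?_
      gcongr
      norm_num
    _ = _ := by
      rw [setLIntegral_const, Real.volume_Icc]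
      simp only [sub_zero, ENNReal.ofReal_one, mul_one, pow_add]
      ring

open Set Metric in
theorem setLIntegral_ball_enorm_sub_average_le {E : Type*} [NormedAddCommGroup E] [NormedSpace ℝ E]
    [FiniteDimensional ℝ E] [MeasurableSpace E] [BorelSpace E] (μ : Measure E)
    [μ.IsAddHaarMeasure] {ψ : E → ℝ} (hψ : ContDiff ℝ 1 ψ) :
    ∫⁻ y in ball (0 : E) 1, ‖ψ y - ⨍ z in ball (0 : E) 1, ψ z ∂μ‖ₑ ∂μ ≤
      2 ^ (Module.finrank ℝ E + 2) * ∫⁻ x in ball (0 : E) 1, ‖fderiv ℝ ψ x‖ₑ ∂μ := by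
  have hB0 : μ (ball (0 : E) 1) ≠ 0 := (measure_ball_pos μ 0 one_pos).ne'
  have hB1 : μ (ball (0 : E) 1) ≠ ⊤ := measure_ball_lt_top.ne
  have hBr : μ.real (ball (0 : E) 1) ≠ 0 := ENNReal.toReal_ne_zero.2 ⟨hB0, hB1⟩
  have hi : IntegrableOn ψ (ball (0 : E) 1) μ :=
    (hψ.continuous.continuousOn.integrableOn_compact (isCompact_closedBall 0 1)).mono_set
      ball_subset_closedBall
  have hy (y : E) : ‖ψ y - ⨍ z in ball (0 : E) 1, ψ z ∂μ‖ₑ ≤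
      (μ (ball (0 : E) 1))⁻¹ * ∫⁻ z in ball (0 : E) 1, ‖ψ y - ψ z‖ₑ ∂μ := by
    have h1 : ψ y - ⨍ z in ball (0 : E) 1, ψ z ∂μ =
        (μ.real (ball (0 : E) 1))⁻¹ • ∫ z in ball (0 : E) 1, (ψ y - ψ z) ∂μ := by
      rw [integral_sub (integrableOn_const (C := ψ y) hB1).integrable hi, setAverage_eq, setIntegral_const]
      simp only [smul_eq_mul]
      field_simp
    rw [h1, enorm_smul]
    gcongr
    · rw [enorm_inv hBr, measureReal_def,
        Real.enorm_toReal hB1]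
    · exact enorm_integral_le_lintegral_enorm _
  refine (lintegral_mono hy).trans ?_
  rw [lintegral_const_mul' _ _ (ENNReal.inv_ne_top.2 hB0)]
  refine (mul_le_mul_right (lintegral_lintegral_ball_enorm_sub_le μ hψ) _).trans_eq ?_
  rw [mul_comm (2 ^ _), mul_assoc, ← mul_assoc, ENNReal.inv_mul_cancel hB0 hB1, one_mul]

theorem norm_normalize_sub_normalize_le {E : Type*} [NormedAddCommGroup E] [NormedSpace ℝ E]
    {a b : E} (ha : 1 ≤ ‖a‖) (hb : 1 ≤ ‖b‖) :
    ‖‖a‖⁻¹ • a - ‖b‖⁻¹ • b‖ ≤ 2 * ‖a - b‖ := by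
  have ha0 : 0 < ‖a‖ := by linarith
  have hb0 : 0 < ‖b‖ := by linarith
  have h1 : ‖a‖⁻¹ • a - ‖b‖⁻¹ • b = ‖a‖⁻¹ • ((a - b) + ((‖b‖ - ‖a‖) * ‖b‖⁻¹) • b) := by
    rw [smul_add, smul_sub, smul_smul, sub_mul, mul_inv_cancel₀ hb0.ne', mul_sub,
      ← mul_assoc, inv_mul_cancel₀ ha0.ne', sub_smul]
    simp
  have h2 : ‖(((‖b‖ - ‖a‖) * ‖b‖⁻¹) • b)‖ ≤ ‖a - b‖ := by
    rw [norm_smul, norm_mul, norm_inv, norm_norm, mul_assoc, inv_mul_cancel₀ hb0.ne', mul_one,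
      norm_sub_rev a b]
    exact abs_norm_sub_norm_le b a
  rw [h1, norm_smul, norm_inv, norm_norm]
  calc
    _ ≤ 1 * (‖a - b‖ + ‖a - b‖) := by
      gcongr
      · exact inv_le_one_of_one_le₀ ha
      · exact (norm_add_le _ _).trans (by gcongr)
    _ = _ := by ring

/-- The radial projection to the unit sphere of the face `x i = ε` of a cube. -/
noncomputable def cubeFaceToSphere (i : Fin 3) (ε : ℝ) (p : Fin 2 → ℝ) :
    EuclideanSpace ℝ (Fin 3) :=
  ‖WithLp.toLp 2 (i.insertNth ε p : Fin 3 → ℝ)‖⁻¹ • WithLp.toLp 2 (i.insertNth ε p : Fin 3 → ℝ)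

theorem one_le_norm_insertNth (i : Fin 3) {ε : ℝ} (hε : |ε| = 1) (p : Fin 2 → ℝ) :
    1 ≤ ‖(WithLp.toLp 2 (i.insertNth ε p : Fin 3 → ℝ) : EuclideanSpace ℝ (Fin 3))‖ := by
  have := PiLp.norm_apply_le (WithLp.toLp 2 (i.insertNth ε p : Fin 3 → ℝ) :
    EuclideanSpace ℝ (Fin 3)) i
  simpa [hε] using this

theorem exists_lipschitzWith_cubeFaceToSphere :
    ∃ K : NNReal, ∀ (i : Fin 3) (ε : ℝ), |ε| = 1 → LipschitzWith K (cubeFaceToSphere i ε) := by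
  obtain ⟨L, hL⟩ : ∃ L : NNReal, LipschitzWith L
      (WithLp.toLp 2 : (Fin 3 → ℝ) → EuclideanSpace ℝ (Fin 3)) :=
    ⟨_, PiLp.lipschitzWith_toLp 2 _⟩
  refine ⟨2 * L, fun i ε hε ↦ LipschitzWith.of_dist_le_mul fun p q ↦ ?_⟩
  have h1 := norm_normalize_sub_normalize_le (one_le_norm_insertNth i hε p)
    (one_le_norm_insertNth i hε q)
  rw [← dist_eq_norm, ← dist_eq_norm] at h1
  refine h1.trans ?_
  rw [NNReal.coe_mul, NNReal.coe_ofNat, mul_assoc]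
  gcongr
  refine (hL.dist_le_mul _ _).trans ?_
  gcongr
  rw [dist_pi_le_iff dist_nonneg, i.forall_iff_succAbove]
  exact ⟨by simp, fun j ↦ by simpa using dist_le_pi_dist p q j⟩

theorem cubeFaceToSphere_inv_smul_removeNth (i : Fin 3) {ε : ℝ} (hε : |ε| = 1)
    {z : EuclideanSpace ℝ (Fin 3)} (hz : 0 < ε * z i) :
    cubeFaceToSphere i ε ((ε * z i)⁻¹ • i.removeNth (WithLp.ofLp z)) = ‖z‖⁻¹ • z := by
  have hεε : ε * ε = 1 := by rw [← abs_mul_abs_self, hε, one_mul]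
  have hw : (WithLp.toLp 2 (i.insertNth ε ((ε * z i)⁻¹ • i.removeNth (WithLp.ofLp z)) :
      Fin 3 → ℝ) : EuclideanSpace ℝ (Fin 3)) = (ε * z i)⁻¹ • z := by
    refine PiLp.ext (i.forall_iff_succAbove.2 ⟨?_, fun j ↦ ?_⟩)
    · have : z i ≠ 0 := right_ne_zero_of_mul hz.ne'
      simp only [Fin.insertNth_apply_same, PiLp.smul_apply, smul_eq_mul]
      field_simp
      rw [eq_div_iff (by rintro rfl; simp at hε), hεε]
    · simp [Fin.removeNth]
  rw [cubeFaceToSphere, hw, norm_smul, norm_inv, norm_of_nonneg hz.le, smul_smul, mul_inv,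
    inv_inv, mul_right_comm, mul_inv_cancel₀ hz.ne', one_mul]

open Set Metric Pointwise in
theorem volume_preimage_cubeFaceToSphere_le (i : Fin 3) {ε : ℝ} (hε : |ε| = 1)
    {s : Set (EuclideanSpace ℝ (Fin 3))} (hs : MeasurableSet s)
    (hsi : ∀ x ∈ s, 1 / 2 < ε * x i) :
    volume (cubeFaceToSphere i ε ⁻¹' s) ≤ 64 * volume (Ioo (0 : ℝ) 1 • s) := by
  have hε0 : ε ≠ 0 := by rintro rfl; simp at hε
  obtain ⟨K, hK⟩ := exists_lipschitzWith_cubeFaceToSphere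
  set P := cubeFaceToSphere i ε ⁻¹' s
  have hP : MeasurableSet P := (hK i ε hε).continuous.measurable hs
  set J : Set ℝ := (ε * ·) ⁻¹' Ioo (1 / 4) (1 / 2)
  have hJm : MeasurableSet J := measurableSet_Ioo.preimage (by fun_prop)
  have hJ : volume J = 4⁻¹ := by
    rw [Real.volume_preimage_mul_left hε0, abs_inv, hε, Real.volume_Ioo,
      ← ENNReal.ofReal_mul (by norm_num), ← ENNReal.ofReal_ofNat,
      ← ENNReal.ofReal_inv_of_pos (by norm_num)]
    norm_num
  set T : Set (ℝ × (Fin 2 → ℝ)) := {u | u.1 ∈ J ∧ (ε * u.1)⁻¹ • u.2 ∈ P}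
  have hT : MeasurableSet T :=
    (hJm.preimage measurable_fst).inter (hP.preimage (by fun_prop))
  have hTlower : 64⁻¹ * volume P ≤ volume T := by
    rw [Measure.volume_eq_prod, Measure.prod_apply hT]
    calc
      64⁻¹ * volume P = ∫⁻ _ in J, 16⁻¹ * volume P := by
        rw [setLIntegral_const, hJ, mul_right_comm, ← ENNReal.mul_inv (by simp) (by simp)]
        norm_num
      _ ≤ ∫⁻ σ in J, volume (Prod.mk σ ⁻¹' T) := by
        refine setLIntegral_mono' hJm fun σ hσ ↦ ?_
        have hσ' : 1 / 4 < ε * σ ∧ ε * σ < 1 / 2 := hσ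
        have hσ0 : 0 < ε * σ := by linarith
        have hslice : Prod.mk σ ⁻¹' T = ((ε * σ)⁻¹ • ·) ⁻¹' P := by
          ext q; simp [T, hσ]
        rw [hslice, Measure.addHaar_preimage_smul _ (inv_ne_zero hσ0.ne')]
        gcongr
        rw [← ENNReal.ofReal_ofNat, ← ENNReal.ofReal_inv_of_pos (by norm_num)]
        refine ENNReal.ofReal_le_ofReal ?_
        rw [Module.finrank_fin_fun, inv_pow, inv_inv, abs_of_pos (by positivity)]
        nlinarith
      _ ≤ _ := setLIntegral_le_lintegral _ _
  have he : MeasurePreserving (fun z : EuclideanSpace ℝ (Fin 3) ↦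
      MeasurableEquiv.piFinSuccAbove (fun _ : Fin 3 ↦ ℝ) i (WithLp.ofLp z)) volume volume :=
    (volume_preserving_piFinSuccAbove (fun _ : Fin 3 ↦ ℝ) i).comp (PiLp.volume_preserving_ofLp _)
  have hTupper : volume T ≤ volume (Ioo (0 : ℝ) 1 • s) := by
    rw [← he.measure_preimage hT.nullMeasurableSet]
    refine measure_mono fun z hz ↦ ?_
    obtain ⟨hz1, hz2⟩ : (1 / 4 < ε * z i ∧ ε * z i < 1 / 2) ∧
      (ε * z i)⁻¹ • i.removeNth (WithLp.ofLp z) ∈ P := hz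
    set p := (ε * z i)⁻¹ • i.removeNth (WithLp.ofLp z)
    have hτ : 0 < ε * z i := by linarith
    have hφ : cubeFaceToSphere i ε p = ‖z‖⁻¹ • z := cubeFaceToSphere_inv_smul_removeNth i hε hτ
    have hz0 : 0 < ‖z‖ := norm_pos_iff.2 (by rintro rfl; simp at hτ)
    have hmem : ‖z‖⁻¹ • z ∈ s := hφ ▸ hz2
    refine ⟨‖z‖, ⟨hz0, ?_⟩, _, hmem, by simp [smul_smul, hz0.ne']⟩
    have h3 := hsi _ hmem
    rw [PiLp.smul_apply, smul_eq_mul, mul_left_comm, ← div_eq_inv_mul, lt_div_iff₀ hz0] at h3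
    linarith
  calc
    volume P = 64 * (64⁻¹ * volume P) := by
      rw [← mul_assoc, ENNReal.mul_inv_cancel (by simp) (by simp), one_mul]
    _ ≤ _ := by gcongr; exact hTlower.trans hTupper

open Set Metric Pointwise in
theorem exists_hausdorffMeasure_le_volume_Ioo_smul :
    ∃ C : NNReal, ∀ s : Set (EuclideanSpace ℝ (Fin 3)), MeasurableSet s → s ⊆ sphere 0 1 →
      μH[2] s ≤ C * volume (Ioo (0 : ℝ) 1 • s) := by
  obtain ⟨K, hK⟩ := exists_lipschitzWith_cubeFaceToSphere
  have hface (i : Fin 3) {ε : ℝ} (hε : |ε| = 1) {s : Set (EuclideanSpace ℝ (Fin 3))}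
      (hs : MeasurableSet s) (hs1 : s ⊆ sphere 0 1) (hsi : ∀ x ∈ s, 1 / 2 < ε * x i) :
      μH[2] s ≤ (K ^ 2 * 64 : NNReal) * volume (Ioo (0 : ℝ) 1 • s) := by
    have hsub : s ⊆ cubeFaceToSphere i ε '' (cubeFaceToSphere i ε ⁻¹' s) := by
      intro x hx
      have hτ : 0 < ε * x i := by linarith [hsi x hx]
      have hφ : cubeFaceToSphere i ε ((ε * x i)⁻¹ • i.removeNth (WithLp.ofLp x)) = x := by
        have hx1 : ‖x‖ = 1 := by simpa using hs1 hx
        rw [cubeFaceToSphere_inv_smul_removeNth i hε hτ, hx1, inv_one, one_smul]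
      exact ⟨_, by rwa [mem_preimage, hφ], hφ⟩
    calc
      μH[2] s ≤ K ^ (2 : ℝ) * μH[2] (cubeFaceToSphere i ε ⁻¹' s) :=
        (measure_mono hsub).trans ((hK i ε hε).hausdorffMeasure_image_le zero_le_two _)
      _ = K ^ 2 * volume (cubeFaceToSphere i ε ⁻¹' s) := by
        have h := hausdorffMeasure_pi_real (ι := Fin 2)
        rw [Fintype.card_fin, Nat.cast_ofNat] at h
        rw [h, ENNReal.rpow_ofNat]
      _ ≤ K ^ 2 * (64 * volume (Ioo (0 : ℝ) 1 • s)) := by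
        gcongr
        exact volume_preimage_cubeFaceToSphere_le i hε hs hsi
      _ = _ := by push_cast; ring
  refine ⟨6 * (K ^ 2 * 64), fun s hs hs1 ↦ ?_⟩
  set H : Fin 3 × Bool → Set (EuclideanSpace ℝ (Fin 3)) :=
    fun k ↦ {x ∈ s | 1 / 2 < (if k.2 then 1 else -1) * x k.1}
  have hcover : s ⊆ ⋃ k, H k := by
    intro x hx
    by_contra hcon
    simp only [mem_iUnion, Prod.exists, Bool.exists_bool, H, mem_ofPred_eq, hx, true_and, not_exists,
      not_or, not_lt] at hcon
    have hx1 : ‖x‖ ^ 2 = 1 := by simp [show ‖x‖ = 1 by simpa using hs1 hx]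
    rw [EuclideanSpace.real_norm_sq_eq, Fin.sum_univ_three] at hx1
    have hb (i : Fin 3) : x i ^ 2 ≤ 1 / 4 := by
      have h := hcon i
      norm_num at h
      nlinarith
    linarith [hb 0, hb 1, hb 2]
  have hmeas (k : Fin 3 × Bool) : Measurable fun x : EuclideanSpace ℝ (Fin 3) ↦
      (if k.2 then (1 : ℝ) else -1) * x k.1 := by fun_prop
  calc
    μH[2] s ≤ ∑ k, μH[2] (H k) :=
      (measure_mono hcover).trans (measure_iUnion_fintype_le _ _)
    _ ≤ ∑ k : Fin 3 × Bool, (K ^ 2 * 64 : NNReal) * volume (Ioo (0 : ℝ) 1 • s) := by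
      refine Finset.sum_le_sum fun k _ ↦ ?_
      have hHm : MeasurableSet (H k) :=
        hs.inter (measurableSet_lt measurable_const (hmeas k))
      refine (hface k.1 (by split_ifs <;> simp) hHm (fun x hx ↦ hs1 hx.1)
        fun x hx ↦ hx.2).trans ?_
      gcongr
      exact fun x hx ↦ hx.1
    _ = _ := by
      simp only [Finset.sum_const, Finset.card_univ, Fintype.card_prod, Fintype.card_fin,
        Fintype.card_bool, nsmul_eq_mul]
      push_cast
      ring

open Set Metric in
theorem exists_comap_hausdorffMeasure_le_toSphere :
    ∃ C : NNReal, (μH[2] : Measure (EuclideanSpace ℝ (Fin 3))).comap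
      ((↑) : sphere (0 : EuclideanSpace ℝ (Fin 3)) 1 → EuclideanSpace ℝ (Fin 3)) ≤
        C • (volume : Measure (EuclideanSpace ℝ (Fin 3))).toSphere := by
  obtain ⟨C, hC⟩ := exists_hausdorffMeasure_le_volume_Ioo_smul
  refine ⟨C, Measure.le_iff.2 fun s hs ↦ ?_⟩
  have hm : MeasurableSet ((↑) '' s : Set (EuclideanSpace ℝ (Fin 3))) :=
    (MeasurableEmbedding.subtype_coe isClosed_sphere.measurableSet).measurableSet_image.2 hs
  rw [comap_subtype_coe_apply isClosed_sphere.measurableSet, Measure.smul_apply,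
    Measure.toSphere_apply' _ hs]
  refine (hC _ hm (by rintro _ ⟨x, -, rfl⟩; exact x.2)).trans ?_
  rw [ENNReal.smul_def, smul_eq_mul]
  gcongr
  refine le_mul_of_one_le_left zero_le ?_
  simp

theorem sq_integral_le_measureReal_univ_mul_integral_sq {α : Type*} [MeasurableSpace α]
    {μ : Measure α} [IsFiniteMeasure μ] {f : α → ℝ} (hf : Integrable f μ)
    (hf2 : Integrable (fun x ↦ f x ^ 2) μ) :
    (∫ x, f x ∂μ) ^ 2 ≤ μ.real Set.univ * ∫ x, f x ^ 2 ∂μ := by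
  rcases eq_or_ne μ 0 with rfl | hμ
  · simp
  have hV : 0 < μ.real Set.univ := by
    rw [measureReal_def, ENNReal.toReal_pos_iff]
    simp [pos_iff_ne_zero, hμ]
  set V := μ.real Set.univ
  set I := ∫ x, f x ∂μ
  have h0 : 0 ≤ ∫ x, (f x - I / V) ^ 2 ∂μ := integral_nonneg fun x ↦ sq_nonneg _
  have h1 : ∫ x, (f x - I / V) ^ 2 ∂μ = (∫ x, f x ^ 2 ∂μ) - 2 * (I / V) * I + V * (I / V) ^ 2 := by
    have : ∀ x, (f x - I / V) ^ 2 = f x ^ 2 - 2 * (I / V) * f x + (I / V) ^ 2 := fun x ↦ by ring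
    simp_rw [this]
    have hsub : Integrable (fun x ↦ f x ^ 2 - 2 * (I / V) * f x) μ := hf2.sub (hf.const_mul _)
    rw [integral_add hsub (integrable_const _), integral_sub hf2 (hf.const_mul _), integral_const_mul, integral_const, smul_eq_mul]
  have h2 : V * ((∫ x, f x ^ 2 ∂μ) - 2 * (I / V) * I + V * (I / V) ^ 2) =
      V * (∫ x, f x ^ 2 ∂μ) - I ^ 2 := by
    field_simp
    ring
  have h3 := mul_nonneg hV.le (h1 ▸ h0)
  linarith

open Set Metric in
theorem exists_integral_unit_sphere_abs_sub_average_le :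
    ∃ C : ℝ, 0 ≤ C ∧ ∀ φ : EuclideanSpace ℝ (Fin 3) → ℝ, ContDiff ℝ 1 φ →
      ∫ x in sphere (0 : EuclideanSpace ℝ (Fin 3)) 1,
          |φ x - ⨍ y in ball (0 : EuclideanSpace ℝ (Fin 3)) 1, φ y| ∂μH[2] ≤
        C * √(∫ x in ball (0 : EuclideanSpace ℝ (Fin 3)) 1, ‖fderiv ℝ φ x‖ ^ 2) := by
  obtain ⟨K, hK⟩ := exists_comap_hausdorffMeasure_le_toSphere
  set B := ball (0 : EuclideanSpace ℝ (Fin 3)) 1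
  refine ⟨K * 97 * √(volume.real B), by positivity, fun φ hφ ↦ ?_⟩
  set m := ⨍ y in B, φ y
  have hφ' : Continuous (fderiv ℝ φ) := hφ.continuous_fderiv one_ne_zero
  have hint {f : EuclideanSpace ℝ (Fin 3) → ℝ} (hf : Continuous f) : IntegrableOn f B :=
    (hf.continuousOn.integrableOn_compact (isCompact_closedBall 0 1)).mono_set ball_subset_closedBall
  have hsphere : ∫⁻ x in sphere (0 : EuclideanSpace ℝ (Fin 3)) 1, ‖φ x - m‖ₑ ∂μH[2] ≤
      K * 97 * ∫⁻ x in B, ‖fderiv ℝ φ x‖ₑ := by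
    have htrace := lintegral_toSphere_enorm_le (volume : Measure (EuclideanSpace ℝ (Fin 3)))
      (h := fun x ↦ φ x - m) (by fun_prop)
    have hpoincare := setLIntegral_ball_enorm_sub_average_le
      (volume : Measure (EuclideanSpace ℝ (Fin 3))) hφ
    simp only [fderiv_sub_const, finrank_euclideanSpace_fin, Nat.cast_ofNat] at htrace hpoincare
    calc
      _ = ∫⁻ x : sphere (0 : EuclideanSpace ℝ (Fin 3)) 1, ‖φ x - m‖ₑ 
          ∂(μH[2] : Measure (EuclideanSpace ℝ (Fin 3))).comap (↑) :=
        (lintegral_subtype_comap isClosed_sphere.measurableSet fun x ↦ ‖φ x - m‖ₑ).symm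
      _ ≤ K * ∫⁻ x : sphere (0 : EuclideanSpace ℝ (Fin 3)) 1, ‖φ x - m‖ₑ ∂volume.toSphere := by
        refine (lintegral_mono' hK le_rfl).trans_eq ?_
        rw [lintegral_smul_measure, ENNReal.smul_def, smul_eq_mul]
      _ ≤ K * (3 * (2 ^ (3 + 2) * ∫⁻ x in B, ‖fderiv ℝ φ x‖ₑ) +
            ∫⁻ x in B, ‖fderiv ℝ φ x‖ₑ) := by
        gcongr
        exact htrace.trans (by gcongr)
      _ = _ := by ring
  have hgrad : ∫⁻ x in B, ‖fderiv ℝ φ x‖ₑ = ENNReal.ofReal (∫ x in B, ‖fderiv ℝ φ x‖) := by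
    rw [ofReal_integral_eq_lintegral_ofReal (hint hφ'.norm)
      (ae_of_all _ fun x ↦ norm_nonneg _)]
    simp_rw [ofReal_norm]
  have hCS : ∫ x in B, ‖fderiv ℝ φ x‖ ≤
      √(volume.real B) * √(∫ x in B, ‖fderiv ℝ φ x‖ ^ 2) := by
    have : IsFiniteMeasure (volume.restrict B) := ⟨by simp [B]⟩
    rw [← Real.sqrt_mul measureReal_nonneg]
    refine Real.le_sqrt_of_sq_le ?_
    simpa using sq_integral_le_measureReal_univ_mul_integral_sq (hint hφ'.norm)
      (hint (hφ'.norm.pow 2))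
  calc
    _ = (∫⁻ x in sphere (0 : EuclideanSpace ℝ (Fin 3)) 1, ‖φ x - m‖ₑ ∂μH[2]).toReal := by
      simp_rw [← Real.norm_eq_abs]
      exact integral_norm_eq_lintegral_enorm
        (hφ.continuous.sub continuous_const).measurable.aestronglyMeasurable
    _ ≤ (K * 97 * ENNReal.ofReal (∫ x in B, ‖fderiv ℝ φ x‖)).toReal :=
      ENNReal.toReal_mono (by finiteness) (hgrad ▸ hsphere)
    _ = K * 97 * ∫ x in B, ‖fderiv ℝ φ x‖ := by
      simp [ENNReal.toReal_ofReal (integral_nonneg fun x ↦ norm_nonneg (fderiv ℝ φ x))]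
    _ ≤ _ := by
      rw [mul_assoc _ √_]
      gcongr

open Metric in
theorem integral_sphere_hausdorffMeasure_comp_smul {E : Type*} [NormedAddCommGroup E]
    [NormedSpace ℝ E] [MeasurableSpace E] [BorelSpace E] {d : ℝ} (hd : 0 ≤ d) {r : ℝ} (hr : 0 < r)
    (f : E → ℝ) :
    ∫ x in sphere (0 : E) r, f x ∂μH[d] = r ^ d * ∫ x in sphere (0 : E) 1, f (r • x) ∂μH[d] := by
  have hmap : (μH[d] : Measure E).map (r • ·) = ‖r‖₊⁻¹ ^ d • μH[d] := by
    rw [← map_homothety_hausdorffMeasure hd (0 : E) hr.ne']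
    congr 1 with x
    simp [AffineMap.homothety_apply]
  have hpre : (r • ·) ⁻¹' sphere (0 : E) r = sphere 0 1 := by
    ext x
    simp [norm_smul, abs_of_pos hr, hr.ne']
  have hemb : MeasurableEmbedding (r • · : E → E) :=
    (Homeomorph.smulOfNeZero r hr.ne').measurableEmbedding
  have h := hemb.setIntegral_map (μ := μH[d]) f (sphere 0 r)
  rw [hpre, hmap, Measure.restrict_smul, integral_smul_nnreal_measure, NNReal.smul_def] at h
  rw [← h, NNReal.coe_rpow, NNReal.coe_inv, coe_nnnorm, norm_of_nonneg hr.le, smul_eq_mul,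
    Real.inv_rpow hr.le, mul_inv_cancel_left₀ (Real.rpow_pos_of_pos hr d).ne']

open Metric in
theorem hausdorffMeasure_real_sphere {E : Type*} [NormedAddCommGroup E]
    [NormedSpace ℝ E] [MeasurableSpace E] [BorelSpace E] {d : ℝ} (hd : 0 ≤ d) {r : ℝ} (hr : 0 < r) :
    (μH[d] (sphere (0 : E) r)).toReal = r ^ d * (μH[d] (sphere (0 : E) 1)).toReal := by
  simpa [measureReal_def] using integral_sphere_hausdorffMeasure_comp_smul (E := E) hd hr 1

open Metric in
theorem setIntegral_ball_comp_smul {E : Type*} [NormedAddCommGroup E] [NormedSpace ℝ E]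
    [FiniteDimensional ℝ E] [MeasurableSpace E] [BorelSpace E] (μ : Measure E)
    [μ.IsAddHaarMeasure] {r : ℝ} (hr : 0 < r) (f : E → ℝ) :
    ∫ x in ball (0 : E) 1, f (r • x) ∂μ =
      (r ^ Module.finrank ℝ E)⁻¹ * ∫ x in ball (0 : E) r, f x ∂μ := by
  rw [Measure.setIntegral_comp_smul_of_pos _ _ _ hr, smul_unitBall_of_pos hr, smul_eq_mul]

/-- Trace/Poincaré-type estimate: there is a universal constant `C > 0` such that for
every `r > 0` and every `C¹` function `ψ : ℝ³ → ℝ`, the average over the sphere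
`∂B_r(0)` (with surface measure `σ_r = μH[2]`) of the deviation of `ψ` from its
average over the ball `B_r(0)` is at most `C r^{-1/2} ‖∇ψ‖_{L²(B_r(0))}`. -/
theorem stmt12 :
    ∃ C > (0 : ℝ),
      ∀ (r : ℝ), 0 < r →
        ∀ ψ : EuclideanSpace ℝ (Fin 3) → ℝ,
          ContDiff ℝ 1 ψ →
          ((μH[2] (Metric.sphere (0 : EuclideanSpace ℝ (Fin 3)) r)).toReal)⁻¹ *
              (∫ x in Metric.sphere (0 : EuclideanSpace ℝ (Fin 3)) r,
                |ψ x - ((volume (Metric.ball (0 : EuclideanSpace ℝ (Fin 3)) r)).toReal)⁻¹ *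
                  ∫ y in Metric.ball (0 : EuclideanSpace ℝ (Fin 3)) r, ψ y| ∂(μH[2])) ≤
            C * r ^ (-(1 : ℝ)/2) *
              Real.sqrt (∫ x in Metric.ball (0 : EuclideanSpace ℝ (Fin 3)) r,
                ‖fderiv ℝ ψ x‖ ^ 2) := by
  obtain ⟨C, hC, hunit⟩ := exists_integral_unit_sphere_abs_sub_average_le
  set S := (μH[2] (Metric.sphere (0 : EuclideanSpace ℝ (Fin 3)) 1)).toReal
  refine ⟨S⁻¹ * C + 1, by positivity, fun r hr ψ hψ ↦ ?_⟩
  have hmean : (volume (Metric.ball (0 : EuclideanSpace ℝ (Fin 3)) r)).toReal⁻¹ *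
      ∫ y in Metric.ball (0 : EuclideanSpace ℝ (Fin 3)) r, ψ y =
        ⨍ y in Metric.ball (0 : EuclideanSpace ℝ (Fin 3)) 1, ψ (r • y) := by
    rw [setAverage_eq, setIntegral_ball_comp_smul _ hr, smul_eq_mul, ← mul_assoc,
      Measure.addHaar_ball _ _ hr.le, ENNReal.toReal_mul,
      ENNReal.toReal_ofReal (by positivity), mul_inv_rev, measureReal_def]
  have hgrad : ∫ x in Metric.ball (0 : EuclideanSpace ℝ (Fin 3)) 1,
      ‖fderiv ℝ (fun x ↦ ψ (r • x)) x‖ ^ 2 =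
        r⁻¹ * ∫ x in Metric.ball (0 : EuclideanSpace ℝ (Fin 3)) r, ‖fderiv ℝ ψ x‖ ^ 2 := by
    simp_rw [fderiv_comp_smul, norm_smul, norm_of_nonneg hr.le, mul_pow]
    rw [integral_const_mul, setIntegral_ball_comp_smul _ hr fun x ↦ ‖fderiv ℝ ψ x‖ ^ 2,
      finrank_euclideanSpace_fin]
    field_simp
  have hpow : √r⁻¹ = r ^ (-(1 : ℝ) / 2) := by
    rw [Real.sqrt_eq_rpow, Real.inv_rpow hr.le, ← Real.rpow_neg hr.le, neg_div]
  have h := hunit (fun x ↦ ψ (r • x)) (by fun_prop)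
  rw [hgrad, Real.sqrt_mul (by positivity), hpow] at h
  rw [hmean, hausdorffMeasure_real_sphere zero_le_two hr,
    integral_sphere_hausdorffMeasure_comp_smul zero_le_two hr, mul_inv,
    mul_mul_mul_comm, inv_mul_cancel₀ (Real.rpow_pos_of_pos hr 2).ne', one_mul]
  calc
    _ ≤ S⁻¹ * (C * (r ^ (-(1 : ℝ) / 2) *
        √(∫ x in Metric.ball (0 : EuclideanSpace ℝ (Fin 3)) r, ‖fderiv ℝ ψ x‖ ^ 2))) := by
      gcongr
    _ = S⁻¹ * C * r ^ (-(1 : ℝ) / 2) *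
        √(∫ x in Metric.ball (0 : EuclideanSpace ℝ (Fin 3)) r, ‖fderiv ℝ ψ x‖ ^ 2) := by ring
    _ ≤ _ := by
      gcongr
      linarith
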